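/- Let G be the sibling tree ST_n with n ≥ 1. Then the locating-total domination number of G is γ^L_t(G) = (2^{n+3}-1)/7 if n ≡ 0 (mod 3), γ^L_t(G) = (2^{n+3}-2)/7 if n ≡ 1 (mod 3), and γ^L_t(G) = (2^{n+3}-4)/7 if n ≡ 2 (mod 3). -/

import Mathlib

/-- Vertex labels of a level-`n` complete binary tree: `1, …, 2^(n+1) - 1`. -/
def treeVerts (n : ℕ) : Finset ℕ := Finset.Icc 1 (2 ^ (n + 1) - 1)

/-- The hypertree `HT(n)`: each vertex `x` is adjacent to its children `2x` and `2x+1`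
(when the labels lie in the vertex set), and two vertices at the same level `i`
(`1 ≤ i ≤ n`, i.e. `2^i ≤ x < 2^(i+1)`) are adjacent iff their labels differ by `2^(i-1)`. -/
def hyperTree (n : ℕ) : SimpleGraph ℕ :=
  SimpleGraph.fromRel (fun x y =>
    x ∈ treeVerts n ∧ y ∈ treeVerts n ∧
      (y = 2 * x ∨ y = 2 * x + 1 ∨
        ∃ i, 1 ≤ i ∧ i ≤ n ∧ 2 ^ i ≤ x ∧ x < 2 ^ (i + 1) ∧ 2 ^ i ≤ y ∧ y < 2 ^ (i + 1) ∧
          y = x + 2 ^ (i - 1)))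

/-- The root-fault hypertree `HT*(n)`: the induced subgraph of `HT(n)` obtained by
deleting the root vertex `1`. -/
def rootFaultHyperTree (n : ℕ) : SimpleGraph ℕ :=
  SimpleGraph.fromRel (fun x y => x ≠ 1 ∧ y ≠ 1 ∧ (hyperTree n).Adj x y)

/-- Vertex labels of the root-fault hypertree `HT*(n)`: `2, …, 2^(n+1) - 1`. -/
def rootFaultVerts (n : ℕ) : Finset ℕ := Finset.Icc 2 (2 ^ (n + 1) - 1)

/-- The sibling tree `ST_n`: each vertex `x` is adjacent to its children `2x` and `2x+1`
(when the labels lie in the vertex set), and the two children `2p`, `2p+1` of a common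
parent are adjacent. -/
def siblingTree (n : ℕ) : SimpleGraph ℕ :=
  SimpleGraph.fromRel (fun x y =>
    x ∈ treeVerts n ∧ y ∈ treeVerts n ∧
      (y = 2 * x ∨ y = 2 * x + 1 ∨ ∃ p, x = 2 * p ∧ y = 2 * p + 1))

/-- `S` is a dominating set of the graph `G` with (finite) vertex set `V`:
every vertex of `V` not in `S` is adjacent to some vertex of `S`. -/
def IsDomSetOn (G : SimpleGraph ℕ) (V S : Finset ℕ) : Prop :=
  S ⊆ V ∧ ∀ v ∈ V, v ∉ S → ∃ u ∈ S, G.Adj u v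

/-- `S` is a total dominating set of the graph `G` with (finite) vertex set `V`:
every vertex of `V` is adjacent to some vertex of `S`. -/
def IsTotalDomSetOn (G : SimpleGraph ℕ) (V S : Finset ℕ) : Prop :=
  S ⊆ V ∧ ∀ v ∈ V, ∃ u ∈ S, G.Adj u v

/-- `S` locates the vertices of `V` outside `S`: any two distinct vertices `u, v` of `V`
outside `S` satisfy `N(u) ∩ S ≠ N(v) ∩ S`. -/
def LocatesOn (G : SimpleGraph ℕ) (V S : Finset ℕ) : Prop :=
  ∀ u ∈ V, ∀ v ∈ V, u ∉ S → v ∉ S → u ≠ v →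
    ({w : ℕ | w ∈ S ∧ G.Adj w u} ≠ {w : ℕ | w ∈ S ∧ G.Adj w v})

/-- `S` is a locating-dominating set of `G` with vertex set `V`. -/
def IsLocDomSetOn (G : SimpleGraph ℕ) (V S : Finset ℕ) : Prop :=
  IsDomSetOn G V S ∧ LocatesOn G V S

/-- `S` is a locating-total dominating set of `G` with vertex set `V`. -/
def IsLocTotalDomSetOn (G : SimpleGraph ℕ) (V S : Finset ℕ) : Prop :=
  IsTotalDomSetOn G V S ∧ LocatesOn G V S

/-- The domination number `γ` of the graph `G` with vertex set `V`. -/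
noncomputable def domNum (G : SimpleGraph ℕ) (V : Finset ℕ) : ℕ :=
  sInf {k | ∃ S : Finset ℕ, IsDomSetOn G V S ∧ S.card = k}

/-- The total domination number `γ_t` of the graph `G` with vertex set `V`. -/
noncomputable def totalDomNum (G : SimpleGraph ℕ) (V : Finset ℕ) : ℕ :=
  sInf {k | ∃ S : Finset ℕ, IsTotalDomSetOn G V S ∧ S.card = k}

/-- The locating-domination number `γ^L` of the graph `G` with vertex set `V`. -/
noncomputable def locDomNum (G : SimpleGraph ℕ) (V : Finset ℕ) : ℕ :=
  sInf {k | ∃ S : Finset ℕ, IsLocDomSetOn G V S ∧ S.card = k}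

/-- The locating-total domination number `γ^L_t` of the graph `G` with vertex set `V`. -/
noncomputable def locTotalDomNum (G : SimpleGraph ℕ) (V : Finset ℕ) : ℕ :=
  sInf {k | ∃ S : Finset ℕ, IsLocTotalDomSetOn G V S ∧ S.card = k}

theorem mem_treeVerts {n x : ℕ} : x ∈ treeVerts n ↔ 1 ≤ x ∧ x < 2 ^ (n + 1) := by
  have := Nat.one_le_two_pow (n := n + 1)
  simp only [treeVerts, Finset.mem_Icc]
  omega

theorem siblingTree_adj {n x y : ℕ} : (siblingTree n).Adj x y ↔
    x ∈ treeVerts n ∧ y ∈ treeVerts n ∧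
      (y = 2 * x ∨ y = 2 * x + 1 ∨ x = 2 * y ∨ x = 2 * y + 1 ∨ (x / 2 = y / 2 ∧ x ≠ y)) := by
  simp only [siblingTree, SimpleGraph.fromRel_adj, mem_treeVerts]
  constructor
  · rintro ⟨hne, ⟨hx, hy, h | h | ⟨p, h⟩⟩ | ⟨hy, hx, h | h | ⟨p, h⟩⟩⟩ <;>
      exact ⟨hx, hy, by omega⟩
  · rintro ⟨hx, hy, h⟩
    refine ⟨by omega, ?_⟩
    rcases h with h | h | h | h | h
    · exact Or.inl ⟨hx, hy, Or.inl h⟩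
    · exact Or.inl ⟨hx, hy, Or.inr (Or.inl h)⟩
    · exact Or.inr ⟨hy, hx, Or.inl h⟩
    · exact Or.inr ⟨hy, hx, Or.inr (Or.inl h)⟩
    · rcases Nat.lt_or_gt_of_ne h.2 with hlt | hlt
      · exact Or.inl ⟨hx, hy, Or.inr (Or.inr ⟨x / 2, by omega⟩)⟩
      · exact Or.inr ⟨hy, hx, Or.inr (Or.inr ⟨x / 2, by omega⟩)⟩

/-- The number of elements of `S` in the depth-`h` binary subtree rooted at `x`. -/
def subtreeCount (S : Finset ℕ) : ℕ → ℕ → ℕ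
  | 0, x => if x ∈ S then 1 else 0
  | h + 1, x => (if x ∈ S then 1 else 0) + subtreeCount S h (2 * x) + subtreeCount S h (2 * x + 1)

theorem subtreeCount_eq_sum (S : Finset ℕ) (h x : ℕ) : subtreeCount S h x =
    ∑ j ∈ Finset.range (h + 1),
      ∑ i ∈ Finset.Ico (2 ^ j * x) (2 ^ j * (x + 1)), if i ∈ S then 1 else 0 := by
  induction h generalizing x with
  | zero => simp [subtreeCount, -Finset.sum_boole, -Finset.sum_ite_mem]
  | succ h ih =>
    rw [subtreeCount, ih, ih, Finset.sum_range_succ' _ (h + 1), add_assoc, ← Finset.sum_add_distrib,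
      add_comm]
    congr 1
    · refine Finset.sum_congr rfl fun j _ => ?_
      rw [Finset.sum_Ico_consecutive _ (by gcongr; omega) (by gcongr; omega)]
      congr 2 <;> ring
    · simp [-Finset.sum_boole, -Finset.sum_ite_mem]

theorem subtreeCount_root {S : Finset ℕ} {n : ℕ} (hS : S ⊆ treeVerts n) :
    subtreeCount S n 1 = S.card := by
  have hlevels : ∀ m, ∑ j ∈ Finset.range m,
      ∑ i ∈ Finset.Ico (2 ^ j * 1) (2 ^ j * (1 + 1)), (if i ∈ S then 1 else 0) =
      ∑ i ∈ Finset.Ico 1 (2 ^ m), if i ∈ S then 1 else 0 := by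
    intro m
    induction m with
    | zero => simp
    | succ m ih =>
      rw [Finset.sum_range_succ, ih, mul_one, one_add_one_eq_two, ← pow_succ,
        Finset.sum_Ico_consecutive _ Nat.one_le_two_pow (by gcongr <;> omega)]
  rw [subtreeCount_eq_sum, hlevels, ← Finset.card_filter]
  congr 1
  ext x
  have := @hS x
  simp only [Finset.mem_filter, Finset.mem_Ico, mem_treeVerts] at this ⊢
  tauto

/-- The least number of vertices a locating-total dominating set can have in a depth-`h` subtree. -/
def subtreeBound : ℕ → ℕ
  | 0 => 0
  | h + 1 => 2 * subtreeBound h + if h % 3 = 0 then 2 else 0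

theorem subtreeBound_closed (h : ℕ) :
    7 * subtreeBound h + (if h % 3 = 0 then 8 else if h % 3 = 1 then 2 else 4) = 2 ^ (h + 3) := by
  induction h with
  | zero => simp [subtreeBound]
  | succ h ih =>
    rw [subtreeBound, show h + 1 + 3 = (h + 3) + 1 by ring, pow_succ, ← ih]
    split_ifs <;> omega

section LowerBound

variable {n : ℕ} {S : Finset ℕ}

theorem IsTotalDomSetOn.child_dominated (hS : IsTotalDomSetOn (siblingTree n) (treeVerts n) S)
    {x y : ℕ} (hx : 1 ≤ x) (hy : y ∈ treeVerts n) (hxy : y / 2 = x) :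
    2 * y ∈ S ∨ 2 * y + 1 ∈ S ∨ x ∈ S ∨ 4 * x + 1 - y ∈ S := by
  obtain ⟨u, hu, hadj⟩ := hS.2 y hy
  rw [siblingTree_adj] at hadj
  obtain h | h | h | h : u = 2 * y ∨ u = 2 * y + 1 ∨ u = x ∨ u = 4 * x + 1 - y := by omega
  all_goals subst h; tauto

theorem LocatesOn.child_located (hS : LocatesOn (siblingTree n) (treeVerts n) S)
    {x : ℕ} (hx : 1 ≤ x) (hy : 2 * x + 1 ∈ treeVerts n) :
    2 * x ∈ S ∨ 2 * x + 1 ∈ S ∨ (2 * (2 * x) ∈ S ∨ 2 * (2 * x) + 1 ∈ S) ∨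
      (2 * (2 * x + 1) ∈ S ∨ 2 * (2 * x + 1) + 1 ∈ S) := by
  by_contra! hcon
  have hy' : 2 * x ∈ treeVerts n := by rw [mem_treeVerts] at *; omega
  refine hS (2 * x) hy' (2 * x + 1) hy (by tauto) (by tauto) (by omega) ?_
  ext w
  refine and_congr_right fun hw => ?_
  have hne : ∀ z, z ∉ S → w ≠ z := fun z hz h => hz (h ▸ hw)
  have h1 := hne _ hcon.1
  have h2 := hne _ hcon.2.1
  have h3 := hne _ hcon.2.2.1.1
  have h4 := hne _ hcon.2.2.1.2
  have h5 := hne _ hcon.2.2.2.1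
  have h6 := hne _ hcon.2.2.2.2
  simp only [siblingTree_adj, hy, hy', true_and]
  refine and_congr_right fun _ => ?_
  omega

theorem IsLocTotalDomSetOn.subtreeBound_le
    (hS : IsLocTotalDomSetOn (siblingTree n) (treeVerts n) S) (h k x : ℕ) (hk : h + k = n)
    (hx : 2 ^ k ≤ x) (hx' : x < 2 ^ (k + 1)) :
    subtreeBound h + (if h % 3 ≠ 1 ∧ x ∈ S then 1 else 0) +
      (if h % 3 = 0 ∧ (2 * x ∈ S ∨ 2 * x + 1 ∈ S) then 1 else 0) ≤ subtreeCount S h x := by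
  induction h generalizing k x with
  | zero =>
    have hnot : ∀ y, 2 * x ≤ y → y ∉ S := fun y hy hyS => by
      have := mem_treeVerts.1 (hS.1.1 hyS)
      obtain rfl : k = n := by omega
      rw [pow_succ] at this
      omega
    simp [subtreeBound, subtreeCount, hnot (2 * x) le_rfl, hnot (2 * x + 1) (by omega)]
  | succ h ih =>
    have hpos : 1 ≤ x := Nat.one_le_two_pow.trans hx
    have e1 : 2 ^ (k + 1) = 2 * 2 ^ k := by ring
    have e2 : 2 ^ (k + 1 + 1) = 2 * 2 ^ (k + 1) := by ring
    have hle : 2 ^ (k + 1 + 1) ≤ 2 ^ (n + 1) := by gcongr <;> omega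
    have hV : 2 * x ∈ treeVerts n := mem_treeVerts.2 (by omega)
    have hV' : 2 * x + 1 ∈ treeVerts n := mem_treeVerts.2 (by omega)
    have i1 := ih (k + 1) (2 * x) (by omega) (by omega) (by omega)
    have i2 := ih (k + 1) (2 * x + 1) (by omega) (by omega) (by omega)
    have d1 := hS.1.child_dominated hpos hV (by omega)
    have d2 := hS.1.child_dominated hpos hV' (by omega)
    rw [show 4 * x + 1 - 2 * x = 2 * x + 1 by omega] at d1
    rw [show 4 * x + 1 - (2 * x + 1) = 2 * x by omega] at d2
    have l := hS.2.child_located hpos hV'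
    simp only [subtreeBound, subtreeCount]
    generalize subtreeCount S h (2 * x) = c1 at *
    generalize subtreeCount S h (2 * x + 1) = c2 at *
    clear ih
    obtain ⟨h0, h1⟩ | ⟨h0, h1⟩ | ⟨h0, h1⟩ : h % 3 = 0 ∧ (h + 1) % 3 = 1 ∨
        h % 3 = 1 ∧ (h + 1) % 3 = 2 ∨ h % 3 = 2 ∧ (h + 1) % 3 = 0 := by omega
    all_goals
      simp only [h0, h1] at *
      grind

theorem IsLocTotalDomSetOn.le_card (hS : IsLocTotalDomSetOn (siblingTree n) (treeVerts n) S) :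
    subtreeBound n + (if n % 3 = 0 then 1 else 0) ≤ S.card := by
  have hle := hS.subtreeBound_le n 0 1 rfl (by simp) (by simp)
  rw [subtreeCount_root hS.1.1] at hle
  obtain ⟨u, hu, hadj⟩ := hS.1.2 1 (mem_treeVerts.2 ⟨le_rfl, Nat.one_lt_two_pow (by omega)⟩)
  rw [siblingTree_adj, mem_treeVerts] at hadj
  have hroot : 2 * 1 ∈ S ∨ 2 * 1 + 1 ∈ S := by
    obtain rfl | rfl : u = 2 * 1 ∨ u = 2 * 1 + 1 := by omega
    exacts [Or.inl hu, Or.inr hu]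
  simp only [hroot, and_true] at hle
  omega

end LowerBound

section Construction

/-- The vertices of height `1` modulo `3`, and those of height `0` modulo `3` with even label. -/
def periodicSet (n : ℕ) : Finset ℕ :=
  {x ∈ treeVerts n | (n - Nat.log 2 x) % 3 = 1 ∨ (n - Nat.log 2 x) % 3 = 0 ∧ x % 2 = 0}

/-- An optimal locating-total dominating set of the sibling tree. -/
def optimalSet (n : ℕ) : Finset ℕ :=
  if n % 3 = 0 then insert 2 (periodicSet n) else periodicSet n

theorem log_two_of_div_two {x y : ℕ} (hx : 1 ≤ x) (hy : y / 2 = x) :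
    Nat.log 2 y = Nat.log 2 x + 1 := by
  rw [Nat.log_of_one_lt_of_le (by omega) (by omega), hy]

theorem log_two_le {n x : ℕ} (hx : x ∈ treeVerts n) : Nat.log 2 x ≤ n :=
  Nat.lt_succ_iff.1 (Nat.log_lt_of_lt_pow (by have := mem_treeVerts.1 hx; omega)
    (mem_treeVerts.1 hx).2)

theorem mem_treeVerts_of_log {n x : ℕ} (hx : 1 ≤ x) (h : Nat.log 2 x ≤ n) : x ∈ treeVerts n :=
  mem_treeVerts.2 ⟨hx, (Nat.lt_pow_succ_log_self one_lt_two x).trans_le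
    (Nat.pow_le_pow_right two_pos (by omega))⟩

theorem subtreeCount_periodicSet (n h k x : ℕ) (hk : h + k = n)
    (hx : 2 ^ k ≤ x) (hx' : x < 2 ^ (k + 1)) :
    subtreeCount (periodicSet n) h x =
      subtreeBound h + if h % 3 = 0 ∧ x % 2 = 0 then 1 else 0 := by
  have hmem : ∀ h k x, h + k = n → 2 ^ k ≤ x → x < 2 ^ (k + 1) →
      (x ∈ periodicSet n ↔ h % 3 = 1 ∨ h % 3 = 0 ∧ x % 2 = 0) := by
    intro h k x hk hx hx'
    have hlog : Nat.log 2 x = k := Nat.log_eq_of_pow_le_of_lt_pow hx hx'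
    have hV : x ∈ treeVerts n :=
      mem_treeVerts_of_log (Nat.one_le_two_pow.trans hx) (by omega)
    rw [periodicSet, Finset.mem_filter, hlog, show n - k = h by omega]
    simp [hV]
  induction h generalizing k x with
  | zero => simp [subtreeCount, subtreeBound, hmem 0 k x hk hx hx']
  | succ h ih =>
    have e1 : 2 ^ (k + 1) = 2 * 2 ^ k := by ring
    have e2 : 2 ^ (k + 1 + 1) = 2 * 2 ^ (k + 1) := by ring
    rw [subtreeCount, ih (k + 1) (2 * x) (by omega) (by omega) (by omega),
      ih (k + 1) (2 * x + 1) (by omega) (by omega) (by omega), subtreeBound]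
    simp only [hmem (h + 1) k x hk hx hx']
    split_ifs <;> omega

theorem periodicSet_subset (n : ℕ) : periodicSet n ⊆ treeVerts n := Finset.filter_subset _ _

theorem card_periodicSet (n : ℕ) : (periodicSet n).card = subtreeBound n := by
  rw [← subtreeCount_root (periodicSet_subset n),
    subtreeCount_periodicSet n n 0 1 rfl (by simp) (by simp)]
  simp

theorem card_optimalSet_le (n : ℕ) :
    (optimalSet n).card ≤ subtreeBound n + if n % 3 = 0 then 1 else 0 := by
  rw [optimalSet]
  split_ifs
  · exact (Finset.card_insert_le _ _).trans (by rw [card_periodicSet])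
  · rw [card_periodicSet, add_zero]

variable {n : ℕ}

theorem optimalSet_subset (hn : 1 ≤ n) : optimalSet n ⊆ treeVerts n := by
  have h2 : 2 ∈ treeVerts n := mem_treeVerts_of_log (by omega)
    (by rwa [log_two_of_div_two le_rfl (y := 2) rfl, Nat.log_one_right])
  rw [optimalSet]
  split_ifs
  · exact Finset.insert_subset h2 (periodicSet_subset n)
  · exact periodicSet_subset n

theorem periodicSet_subset_optimalSet (n : ℕ) : periodicSet n ⊆ optimalSet n := by
  rw [optimalSet]
  split_ifs
  exacts [Finset.subset_insert _ _, subset_rfl]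

theorem mem_optimalSet {x k : ℕ} (hx : x ∈ treeVerts n) (hk : n - Nat.log 2 x = k)
    (h : k % 3 = 1 ∨ k % 3 = 0 ∧ x % 2 = 0) : x ∈ optimalSet n :=
  periodicSet_subset_optimalSet n (Finset.mem_filter.2 ⟨hx, by rwa [hk]⟩)

/-- A vertex outside `optimalSet n` sees its parent and sibling in the set, or both its children,
unless it is the root. -/
theorem neighbors_of_notMem_optimalSet {x : ℕ} (hx : x ∈ treeVerts n) (hxS : x ∉ optimalSet n) :
    (x % 2 = 1 ∧ 3 ≤ x ∧ x / 2 ∈ optimalSet n ∧ x - 1 ∈ optimalSet n) ∨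
      (2 * x ∈ optimalSet n ∧ 2 * x + 1 ∈ optimalSet n) ∨ (x = 1 ∧ n % 3 = 0) := by
  have hpos := (mem_treeVerts.1 hx).1
  have hlog := log_two_le hx
  have hnot : ¬((n - Nat.log 2 x) % 3 = 1 ∨ (n - Nat.log 2 x) % 3 = 0 ∧ x % 2 = 0) :=
    fun h => hxS (mem_optimalSet hx rfl h)
  have c1 := log_two_of_div_two (y := 2 * x) hpos (by omega)
  have c2 := log_two_of_div_two (y := 2 * x + 1) hpos (by omega)
  by_cases h0 : (n - Nat.log 2 x) % 3 = 0
  · rcases eq_or_ne x 1 with rfl | h1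
    · simp_all
    · have p := log_two_of_div_two (x := x / 2) (y := x) (by omega) rfl
      have s := log_two_of_div_two (x := x / 2) (y := x - 1) (by omega) (by omega)
      exact Or.inl ⟨by omega, by omega,
        mem_optimalSet (mem_treeVerts_of_log (by omega) (by omega)) rfl (by omega),
        mem_optimalSet (mem_treeVerts_of_log (by omega) (by omega)) rfl (by omega)⟩
  · exact Or.inr (Or.inl
      ⟨mem_optimalSet (mem_treeVerts_of_log (by omega) (by omega)) rfl (by omega),
        mem_optimalSet (mem_treeVerts_of_log (by omega) (by omega)) rfl (by omega)⟩)

theorem two_mem_optimalSet (h : n % 3 = 0) : 2 ∈ optimalSet n := by simp [optimalSet, h]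

theorem isTotalDomSetOn_optimalSet (hn : 1 ≤ n) :
    IsTotalDomSetOn (siblingTree n) (treeVerts n) (optimalSet n) := by
  have hsub := optimalSet_subset hn
  refine ⟨hsub, fun x hx => ?_⟩
  suffices ∃ u ∈ optimalSet n,
      x = 2 * u ∨ x = 2 * u + 1 ∨ u = 2 * x ∨ u = 2 * x + 1 ∨ (u / 2 = x / 2 ∧ u ≠ x) by
    obtain ⟨u, hu, h⟩ := this
    exact ⟨u, hu, siblingTree_adj.2 ⟨hsub hu, hx, h⟩⟩
  have hpos := (mem_treeVerts.1 hx).1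
  have hlog := log_two_le hx
  by_cases h0 : (n - Nat.log 2 x) % 3 = 0
  · rcases eq_or_ne x 1 with rfl | h1
    · exact ⟨2, two_mem_optimalSet (by simpa using h0), by omega⟩
    · have p := log_two_of_div_two (x := x / 2) (y := x) (by omega) rfl
      exact ⟨x / 2, mem_optimalSet (mem_treeVerts_of_log (by omega) (by omega)) rfl (by omega),
        by omega⟩
  · have c := log_two_of_div_two (y := 2 * x) hpos (by omega)
    exact ⟨2 * x, mem_optimalSet (mem_treeVerts_of_log (by omega) (by omega)) rfl (by omega),
      by omega⟩

theorem locatesOn_optimalSet (hn : 1 ≤ n) :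
    LocatesOn (siblingTree n) (treeVerts n) (optimalSet n) := by
  have hsub := optimalSet_subset hn
  intro u hu v hv huS hvS huv heq
  have hiff : ∀ w ∈ optimalSet n, (siblingTree n).Adj w u ↔ (siblingTree n).Adj w v := by
    intro w hw
    simpa [hw] using Set.ext_iff.1 heq w
  have aux : ∀ a ∈ treeVerts n, ∀ b ∈ treeVerts n, a ∉ optimalSet n → a ≠ b →
      (∀ w ∈ optimalSet n, (siblingTree n).Adj w a → (siblingTree n).Adj w b) → a = 1 := by
    intro a ha b hb haS hab himp
    have hadj : ∀ w ∈ optimalSet n, w ∈ treeVerts n →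
        (a = 2 * w ∨ a = 2 * w + 1 ∨ w = 2 * a ∨ w = 2 * a + 1 ∨ (w / 2 = a / 2 ∧ w ≠ a)) →
        (b = 2 * w ∨ b = 2 * w + 1 ∨ w = 2 * b ∨ w = 2 * b + 1 ∨ (w / 2 = b / 2 ∧ w ≠ b)) :=
      fun w hw hwV h => (siblingTree_adj.1 (himp w hw (siblingTree_adj.2 ⟨hwV, ha, h⟩))).2.2
    have hb1 := (mem_treeVerts.1 hb).1
    rcases neighbors_of_notMem_optimalSet ha haS with ⟨hodd, h3, hp, hs⟩ | ⟨hl, hr⟩ | h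
    · have := hadj _ hp (hsub hp) (by omega)
      have := hadj _ hs (hsub hs) (by omega)
      omega
    · have := hadj _ hl (hsub hl) (by omega)
      have := hadj _ hr (hsub hr) (by omega)
      omega
    · exact h.1
  have h1 := aux u hu v hv huS huv fun w hw => (hiff w hw).1
  have h2 := aux v hv u hu hvS huv.symm fun w hw => (hiff w hw).2
  omega

end Construction

/-- The locating-total domination number of the sibling tree `ST_n`, `n ≥ 1`. -/
theorem locTotalDomNum_siblingTree (n : ℕ) (hn : 1 ≤ n) :
    (n % 3 = 0 → locTotalDomNum (siblingTree n) (treeVerts n) = (2 ^ (n + 3) - 1) / 7) ∧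
    (n % 3 = 1 → locTotalDomNum (siblingTree n) (treeVerts n) = (2 ^ (n + 3) - 2) / 7) ∧
    (n % 3 = 2 → locTotalDomNum (siblingTree n) (treeVerts n) = (2 ^ (n + 3) - 4) / 7) := by
  have hopt : IsLocTotalDomSetOn (siblingTree n) (treeVerts n) (optimalSet n) :=
    ⟨isTotalDomSetOn_optimalSet hn, locatesOn_optimalSet hn⟩
  have hnum : locTotalDomNum (siblingTree n) (treeVerts n) =
      subtreeBound n + if n % 3 = 0 then 1 else 0 := by
    refine IsLeast.csInf_eq ⟨⟨_, hopt, (card_optimalSet_le n).antisymm hopt.le_card⟩, ?_⟩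
    rintro _ ⟨S, hS, rfl⟩
    exact hS.le_card
  have hclosed := subtreeBound_closed n
  rw [hnum]
  split_ifs at hclosed ⊢ <;> omega
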